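/- Adversarial uncertainty bound: let S, X, Z be random variables on finite sets such that S and Z are conditionally independent given X (the Markov chain S → X → Z), and suppose the conditional distribution of Z given X is realized by a Markov kernel satisfying ε-LDP. Then the conditional entropy of the sensitive variable given the released representation satisfies H(S | Z) ≥ H(S) − ε + I(X; Z | S). -/

import Mathlib

open Finset

noncomputable section

/-- A Markov kernel between finite types: each row is a probability mass function. -/
def IsMarkovKernel' {A B : Type*} [Fintype B] (K : A → B → ℝ) : Prop :=
  (∀ a b, 0 ≤ K a b) ∧ ∀ a, ∑ b, K a b = 1

/-- ε-local differential privacy for a kernel. -/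
def IsLDP {A B : Type*} (ε : ℝ) (K : A → B → ℝ) : Prop :=
  ∀ a a' b, K a b ≤ Real.exp ε * K a' b

variable {S X Z : Type*} [Fintype S] [Fintype X] [Fintype Z]

/-- Marginal of the sensitive variable. -/
def margS (p : S → X → Z → ℝ) (s : S) : ℝ := ∑ x, ∑ z, p s x z

/-- Marginal of the data variable. -/
def margX (p : S → X → Z → ℝ) (x : X) : ℝ := ∑ s, ∑ z, p s x z

/-- Marginal of the representation variable. -/
def margZ (p : S → X → Z → ℝ) (z : Z) : ℝ := ∑ s, ∑ x, p s x z

/-- Marginal of the pair `(S, X)`. -/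
def margSX (p : S → X → Z → ℝ) (s : S) (x : X) : ℝ := ∑ z, p s x z

/-- Marginal of the pair `(S, Z)`. -/
def margSZ (p : S → X → Z → ℝ) (s : S) (z : Z) : ℝ := ∑ x, p s x z

/-- Marginal of the pair `(X, Z)`. -/
def margXZ (p : S → X → Z → ℝ) (x : X) (z : Z) : ℝ := ∑ s, p s x z

/-- Shannon entropy `H(S)` in nats (zero-probability terms vanish). -/
def entS (p : S → X → Z → ℝ) : ℝ := -∑ s, margS p s * Real.log (margS p s)

/-- Conditional entropy `H(S∣Z)` in nats, where `p(s|z) = p(s,z)/p(z)`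
(zero-probability terms vanish). -/
def entSgivenZ (p : S → X → Z → ℝ) : ℝ :=
  -∑ s, ∑ z, margSZ p s z * Real.log (margSZ p s z / margZ p z)

/-- Conditional mutual information `I(X;Z∣S)` in nats (zero-probability terms vanish,
and division by zero is zero by convention). -/
def cmiXZgivenS (p : S → X → Z → ℝ) : ℝ :=
  ∑ s, margS p s * ∑ x, ∑ z,
    (p s x z / margS p s) *
      Real.log ((p s x z / margS p s) /
        ((margSX p s x / margS p s) * (margSZ p s z / margS p s)))

/-- The Markov chain `S → X → Z`: `p(s, z | x) = p(s|x) p(z|x)` whenever `p(x) > 0`. -/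
def MarkovSXZ (p : S → X → Z → ℝ) : Prop :=
  ∀ x, 0 < margX p x → ∀ s z,
    p s x z / margX p x = (margSX p s x / margX p x) * (margXZ p x z / margX p x)

/-- The joint law of a Markov chain factors through the kernel, including at null points. -/
lemma joint_eq_margSX_mul_kernel {p : S → X → Z → ℝ} (hp0 : ∀ s x z, 0 ≤ p s x z)
    (hMarkov : MarkovSXZ p) {K : X → Z → ℝ}
    (hreal : ∀ x z, margXZ p x z = margX p x * K x z) (s : S) (x : X) (z : Z) :
    p s x z = margSX p s x * K x z := by
  have hle (z' : Z) : p s x z' ≤ margX p x :=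
    (single_le_sum (f := fun z' => p s x z') (fun i _ => hp0 s x i) (mem_univ z')).trans
      (single_le_sum (f := fun s' => ∑ z', p s' x z')
        (fun i _ => sum_nonneg fun j _ => hp0 i x j) (mem_univ s))
  rcases ((hp0 s x z).trans (hle z)).eq_or_lt with h0 | hpos
  · have hzero (z' : Z) : p s x z' = 0 := le_antisymm (h0 ▸ hle z') (hp0 s x z')
    simp [margSX, hzero]
  · have h := hMarkov x hpos s z
    rw [hreal] at h
    field_simp at h
    exact h

/-- Under local differential privacy each kernel entry is at most `exp ε` times the output
marginal. -/
lemma kernel_le_exp_mul_margZ {p : S → X → Z → ℝ} (hp0 : ∀ s x z, 0 ≤ p s x z)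
    (hp1 : ∑ s, ∑ x, ∑ z, p s x z = 1) {ε : ℝ} {K : X → Z → ℝ} (hLDP : IsLDP ε K)
    (hreal : ∀ x z, margXZ p x z = margX p x * K x z) (x : X) (z : Z) :
    K x z ≤ Real.exp ε * margZ p z := by
  have hX : ∑ x', margX p x' = 1 := by
    rw [← hp1, sum_comm]; rfl
  have hZ : margZ p z = ∑ x', margX p x' * K x' z := by
    simp only [← hreal]
    exact sum_comm
  calc K x z = ∑ x', margX p x' * K x z := by rw [← sum_mul, hX, one_mul]
    _ ≤ ∑ x', margX p x' * (Real.exp ε * K x' z) :=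
      sum_le_sum fun x' _ => mul_le_mul_of_nonneg_left (hLDP x x' z)
        (sum_nonneg fun s _ => sum_nonneg fun z _ => hp0 s x' z)
    _ = Real.exp ε * margZ p z := by
      rw [hZ, mul_sum]
      exact sum_congr rfl fun x' _ => by ring

/-- Adversarial uncertainty bound: under the Markov chain `S → X → Z` with an ε-LDP
kernel realizing the conditional of `Z` given `X`,
`H(S∣Z) ≥ H(S) − ε + I(X;Z∣S)`. -/
theorem adversarial_uncertainty_bound
    [Nonempty S] [Nonempty X] [Nonempty Z]
    (ε : ℝ) (hε : 0 ≤ ε)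
    (p : S → X → Z → ℝ)
    (hp0 : ∀ s x z, 0 ≤ p s x z) (hp1 : ∑ s, ∑ x, ∑ z, p s x z = 1)
    (hMarkov : MarkovSXZ p)
    (K : X → Z → ℝ) (hK : IsMarkovKernel' K) (hLDP : IsLDP ε K)
    (hreal : ∀ x z, margXZ p x z = margX p x * K x z) :
    entS p - ε + cmiXZgivenS p ≤ entSgivenZ p := by
  have hterm (s : S) (x : X) (z : Z) :
      p s x z * (Real.log (margSZ p s z / margZ p z) - Real.log (margS p s)) +
        margS p s * (p s x z / margS p s * Real.log ((p s x z / margS p s) /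
          ((margSX p s x / margS p s) * (margSZ p s z / margS p s)))) ≤ p s x z * ε := by
    rcases (hp0 s x z).eq_or_lt with h0 | hpos
    · simp [← h0]
    have hSX : 0 < margSX p s x := hpos.trans_le <|
      single_le_sum (f := fun z => p s x z) (fun i _ => hp0 s x i) (mem_univ z)
    have hSZ : 0 < margSZ p s z := hpos.trans_le <|
      single_le_sum (f := fun x => p s x z) (fun i _ => hp0 s i z) (mem_univ x)
    have hS : 0 < margS p s := hSX.trans_le <|
      single_le_sum (f := fun x => ∑ z, p s x z)
        (fun i _ => sum_nonneg fun j _ => hp0 s i j) (mem_univ x)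
    have hZ : 0 < margZ p z := hSZ.trans_le <|
      single_le_sum (f := fun s => ∑ x, p s x z)
        (fun i _ => sum_nonneg fun j _ => hp0 i j z) (mem_univ s)
    have hfac := joint_eq_margSX_mul_kernel hp0 hMarkov hreal s x z
    have hKpos : 0 < K x z := by
      rw [hfac] at hpos
      exact pos_of_mul_pos_right hpos hSX.le
    have hlog : Real.log (K x z) ≤ ε + Real.log (margZ p z) := by
      rw [← Real.log_exp ε, ← Real.log_mul (Real.exp_pos _).ne' hZ.ne']
      exact Real.log_le_log hKpos (kernel_le_exp_mul_margZ hp0 hp1 hLDP hreal x z)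
    have hinfo : (p s x z / margS p s) /
        ((margSX p s x / margS p s) * (margSZ p s z / margS p s)) =
          K x z * margS p s / margSZ p s z := by
      rw [hfac]
      field_simp
    rw [hinfo, ← mul_assoc, mul_div_cancel₀ _ hS.ne', ← mul_add,
      Real.log_div hSZ.ne' hZ.ne', Real.log_div (mul_pos hKpos hS).ne' hSZ.ne',
      Real.log_mul hKpos.ne' hS.ne']
    exact mul_le_mul_of_nonneg_left (by linarith) hpos.le
  have hsum := sum_le_sum fun s (_ : s ∈ univ) => sum_le_sum fun x (_ : x ∈ univ) =>
    sum_le_sum fun z (_ : z ∈ univ) => hterm s x z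
  simp only [mul_sub, sum_add_distrib, sum_sub_distrib, ← sum_mul, hp1, one_mul,
    ← mul_sum] at hsum
  have hS : ∑ s, (∑ x, ∑ z, p s x z) * Real.log (margS p s) =
      ∑ s, margS p s * Real.log (margS p s) := rfl
  have hSZ : ∑ s, ∑ x, ∑ z, p s x z * Real.log (margSZ p s z / margZ p z) =
      ∑ s, ∑ z, margSZ p s z * Real.log (margSZ p s z / margZ p z) :=
    sum_congr rfl fun s _ => by
      rw [sum_comm]
      exact sum_congr rfl fun z _ => (sum_mul ..).symm
  rw [hS, hSZ] at hsum
  unfold entS entSgivenZ cmiXZgivenS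
  linarith

end
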